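/- arXiv:2302.11784 — 6 statements merged into one kernel-verified Lean document; each statement's English description precedes it below -/
import Mathlib

section
/- Let D ⊆ ℝⁿ be a nonempty convex set and Γ = (Γ₁, …, Γ_p) an interval-valued vector function on D such that each Γ_i^L and Γ_i^U is locally Lipschitz on D and admits a bounded convexificator at every point of D, and suppose Γ is ∂-LU-convex on D. If ω ∈ D solves the Minty-type interval-valued vector variational-like inequality (IMVVLIP), then ω is an LU-efficient solution of (IVOP). -/
open RealInnerProductSpace

/-- Lower Dini derivative of `f` at `x` in direction `w` (limit `λ → 0⁺`), valued in `EReal`. -/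
noncomputable def diniLower {n : ℕ} (f : EuclideanSpace ℝ (Fin n) → ℝ)
    (x w : EuclideanSpace ℝ (Fin n)) : EReal :=
  Filter.liminf (fun t : ℝ => (((f (x + t • w) - f x) / t : ℝ) : EReal))
    (nhdsWithin 0 (Set.Ioi 0))

/-- Upper Dini derivative of `f` at `x` in direction `w` (limit `λ → 0⁺`), valued in `EReal`. -/
noncomputable def diniUpperD {n : ℕ} (f : EuclideanSpace ℝ (Fin n) → ℝ)
    (x w : EuclideanSpace ℝ (Fin n)) : EReal :=
  Filter.limsup (fun t : ℝ => (((f (x + t • w) - f x) / t : ℝ) : EReal))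
    (nhdsWithin 0 (Set.Ioi 0))

/-- `S` is a convexificator of `f` at `x`. -/
def IsConvexificatorAt {n : ℕ} (f : EuclideanSpace ℝ (Fin n) → ℝ)
    (x : EuclideanSpace ℝ (Fin n)) (S : Set (EuclideanSpace ℝ (Fin n))) : Prop :=
  IsClosed S ∧
    (∀ w, diniLower f x w ≤ ⨆ ζ ∈ S, ((⟪ζ, w⟫ : ℝ) : EReal)) ∧
    (∀ w, (⨅ ζ ∈ S, ((⟪ζ, w⟫ : ℝ) : EReal)) ≤ diniUpperD f x w)

/-- `f` admits the bounded convexificator `sub x` at every point `x` of `D`. -/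
def HasBoundedConvexificatorOn {n : ℕ} (D : Set (EuclideanSpace ℝ (Fin n)))
    (f : EuclideanSpace ℝ (Fin n) → ℝ)
    (sub : EuclideanSpace ℝ (Fin n) → Set (EuclideanSpace ℝ (Fin n))) : Prop :=
  ∀ x ∈ D, IsConvexificatorAt f x (sub x) ∧ Bornology.IsBounded (sub x)

/-- `f` is locally Lipschitz on `D`. -/
def LocallyLipschitzOnD {n : ℕ} (D : Set (EuclideanSpace ℝ (Fin n)))
    (f : EuclideanSpace ℝ (Fin n) → ℝ) : Prop :=
  ∀ x ∈ D, ∃ M > (0 : ℝ), ∃ δ > (0 : ℝ), ∀ y ∈ D, ∀ z ∈ D,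
    ‖y - x‖ < δ → ‖z - x‖ < δ → |f y - f z| ≤ M * ‖y - z‖

/-- `f` is `∂`-convex on `D` w.r.t. the convexificator map `sub`. -/
def DConvexOn {n : ℕ} (D : Set (EuclideanSpace ℝ (Fin n)))
    (f : EuclideanSpace ℝ (Fin n) → ℝ)
    (sub : EuclideanSpace ℝ (Fin n) → Set (EuclideanSpace ℝ (Fin n))) : Prop :=
  ∀ ω ∈ D, ∀ v ∈ D, ∀ ζ ∈ sub ω, ⟪ζ, v - ω⟫ ≤ f v - f ω

/-- `f` is strictly `∂`-convex on `D` w.r.t. the convexificator map `sub`. -/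
def StrictDConvexOn {n : ℕ} (D : Set (EuclideanSpace ℝ (Fin n)))
    (f : EuclideanSpace ℝ (Fin n) → ℝ)
    (sub : EuclideanSpace ℝ (Fin n) → Set (EuclideanSpace ℝ (Fin n))) : Prop :=
  ∀ ω ∈ D, ∀ v ∈ D, v ≠ ω → ∀ ζ ∈ sub ω, ⟪ζ, v - ω⟫ < f v - f ω

/-- `ω` is an LU-efficient solution of (IVOP) for `Γ_i = [ΓL i, ΓU i]`. -/
def IsLUEfficient {n p : ℕ} (D : Set (EuclideanSpace ℝ (Fin n)))
    (ΓL ΓU : Fin p → EuclideanSpace ℝ (Fin n) → ℝ)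
    (ω : EuclideanSpace ℝ (Fin n)) : Prop :=
  ¬ ∃ v ∈ D, (∀ i, ΓL i v ≤ ΓL i ω ∧ ΓU i v ≤ ΓU i ω) ∧
      (∃ j, (ΓL j v ≤ ΓL j ω ∧ ΓU j v ≤ ΓU j ω) ∧ (ΓL j v ≠ ΓL j ω ∨ ΓU j v ≠ ΓU j ω))

/-- `ω` is a weakly LU-efficient solution of (IVOP). -/
def IsWeakLUEfficient {n p : ℕ} (D : Set (EuclideanSpace ℝ (Fin n)))
    (ΓL ΓU : Fin p → EuclideanSpace ℝ (Fin n) → ℝ)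
    (ω : EuclideanSpace ℝ (Fin n)) : Prop :=
  ¬ ∃ v ∈ D, ∀ i, (ΓL i v ≤ ΓL i ω ∧ ΓU i v ≤ ΓU i ω) ∧
      (ΓL i v ≠ ΓL i ω ∨ ΓU i v ≠ ΓU i ω)

/-- `ω` solves the Minty-type interval-valued vector variational-like inequality. -/
def SolvesIMVVLIP {n p : ℕ} (D : Set (EuclideanSpace ℝ (Fin n)))
    (subL subU : Fin p → EuclideanSpace ℝ (Fin n) → Set (EuclideanSpace ℝ (Fin n)))
    (ω : EuclideanSpace ℝ (Fin n)) : Prop :=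
  ¬ ∃ v ∈ D, ∃ ζL ζU : Fin p → EuclideanSpace ℝ (Fin n),
      (∀ i, ζL i ∈ subL i ω) ∧ (∀ i, ζU i ∈ subU i ω) ∧
      (∀ i, ⟪ζL i, v - ω⟫ ≤ 0 ∧ ⟪ζU i, v - ω⟫ ≤ 0) ∧
      (∃ i, ⟪ζL i, v - ω⟫ < 0 ∨ ⟪ζU i, v - ω⟫ < 0)

/-- `ω` solves the Stampacchia-type interval-valued vector variational-like inequality. -/
def SolvesISVVLIP {n p : ℕ} (D : Set (EuclideanSpace ℝ (Fin n)))
    (subL subU : Fin p → EuclideanSpace ℝ (Fin n) → Set (EuclideanSpace ℝ (Fin n)))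
    (ω : EuclideanSpace ℝ (Fin n)) : Prop :=
  ¬ ∃ v ∈ D, ∃ ξL ξU : Fin p → EuclideanSpace ℝ (Fin n),
      (∀ i, ξL i ∈ subL i v) ∧ (∀ i, ξU i ∈ subU i v) ∧
      (∀ i, ⟪ξL i, v - ω⟫ ≤ 0 ∧ ⟪ξU i, v - ω⟫ ≤ 0) ∧
      (∃ i, ⟪ξL i, v - ω⟫ < 0 ∨ ⟪ξU i, v - ω⟫ < 0)

/-- `ω` solves the weak Minty-type inequality. -/
def SolvesIWMVVLIP {n p : ℕ} (D : Set (EuclideanSpace ℝ (Fin n)))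
    (subL subU : Fin p → EuclideanSpace ℝ (Fin n) → Set (EuclideanSpace ℝ (Fin n)))
    (ω : EuclideanSpace ℝ (Fin n)) : Prop :=
  ¬ ∃ v ∈ D, ∃ ζL ζU : Fin p → EuclideanSpace ℝ (Fin n),
      (∀ i, ζL i ∈ subL i ω) ∧ (∀ i, ζU i ∈ subU i ω) ∧
      (∀ i, ⟪ζL i, v - ω⟫ < 0 ∧ ⟪ζU i, v - ω⟫ < 0)

/-- `ω` solves the weak Stampacchia-type inequality. -/
def SolvesIWSVVLIP {n p : ℕ} (D : Set (EuclideanSpace ℝ (Fin n)))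
    (subL subU : Fin p → EuclideanSpace ℝ (Fin n) → Set (EuclideanSpace ℝ (Fin n)))
    (ω : EuclideanSpace ℝ (Fin n)) : Prop :=
  ¬ ∃ v ∈ D, ∃ ξL ξU : Fin p → EuclideanSpace ℝ (Fin n),
      (∀ i, ξL i ∈ subL i v) ∧ (∀ i, ξU i ∈ subU i v) ∧
      (∀ i, ⟪ξL i, v - ω⟫ < 0 ∧ ⟪ξU i, v - ω⟫ < 0)

/-- A convexificator is nonempty: test the defining inequality in the direction `0`. -/
theorem IsConvexificatorAt.nonempty {n : ℕ} {f : EuclideanSpace ℝ (Fin n) → ℝ}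
    {x : EuclideanSpace ℝ (Fin n)} {S : Set (EuclideanSpace ℝ (Fin n))}
    (h : IsConvexificatorAt f x S) : S.Nonempty := by
  by_contra hS
  rw [Set.not_nonempty_iff_eq_empty] at hS
  have h0 := h.2.1 0
  simp [hS, diniLower, Filter.liminf_const] at h0

theorem stmt_1 {n p : ℕ} (D : Set (EuclideanSpace ℝ (Fin n)))
    (hne : D.Nonempty) (hconv : Convex ℝ D)
    (ΓL ΓU : Fin p → EuclideanSpace ℝ (Fin n) → ℝ)
    (subL subU : Fin p → EuclideanSpace ℝ (Fin n) → Set (EuclideanSpace ℝ (Fin n)))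
    (hint : ∀ i, ∀ x ∈ D, ΓL i x ≤ ΓU i x)
    (hlipL : ∀ i, LocallyLipschitzOnD D (ΓL i))
    (hlipU : ∀ i, LocallyLipschitzOnD D (ΓU i))
    (hcfL : ∀ i, HasBoundedConvexificatorOn D (ΓL i) (subL i))
    (hcfU : ∀ i, HasBoundedConvexificatorOn D (ΓU i) (subU i))
    (hcvxL : ∀ i, DConvexOn D (ΓL i) (subL i))
    (hcvxU : ∀ i, DConvexOn D (ΓU i) (subU i))
    (ω : EuclideanSpace ℝ (Fin n)) (hω : ω ∈ D)
    (hsol : SolvesIMVVLIP D subL subU ω)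
    : IsLUEfficient D ΓL ΓU ω := by
  rintro ⟨v, hv, hle, j, -, hj⟩
  choose ζL hζL using fun i => (hcfL i ω hω).1.nonempty
  choose ζU hζU using fun i => (hcfU i ω hω).1.nonempty
  have hL i := hcvxL i ω hω v hv (ζL i) (hζL i)
  have hU i := hcvxU i ω hω v hv (ζU i) (hζU i)
  refine hsol ⟨v, hv, ζL, ζU, hζL, hζU, fun i => ⟨?_, ?_⟩, j, hj.imp (fun h => ?_) fun h => ?_⟩
  · linarith [hL i, (hle i).1]
  · linarith [hU i, (hle i).2]
  · linarith [hL j, lt_of_le_of_ne (hle j).1 h]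
  · linarith [hU j, lt_of_le_of_ne (hle j).2 h]
end

section
/- Let D ⊆ ℝⁿ be a nonempty convex set and Γ = (Γ₁, …, Γ_p) an interval-valued vector function on D such that each Γ_i^L and Γ_i^U is locally Lipschitz on D and admits a bounded convexificator at every point of D, and suppose Γ is ∂-LU-convex on D. If ω ∈ D is a weakly LU-efficient solution of (IVOP), then ω solves the weak Stampacchia-type inequality (IWSVVLIP). -/
open RealInnerProductSpace

/-- If a `∂`-convex function has at `v` a generalized subgradient `ξ` with `⟪ξ, v - x⟫ < 0`, then its
value at `v` is smaller than its value at `x`. -/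
theorem DConvexOn.lt_of_inner_neg {n : ℕ} {D : Set (EuclideanSpace ℝ (Fin n))}
    {f : EuclideanSpace ℝ (Fin n) → ℝ}
    {sub : EuclideanSpace ℝ (Fin n) → Set (EuclideanSpace ℝ (Fin n))}
    (hf : DConvexOn D f sub) {x v ξ : EuclideanSpace ℝ (Fin n)} (hx : x ∈ D) (hv : v ∈ D)
    (hξ : ξ ∈ sub v) (hneg : ⟪ξ, v - x⟫ < 0) : f v < f x := by
  have h := hf v hv x hx ξ hξ
  rw [← neg_sub v x, inner_neg_right] at h
  linarith

theorem stmt_3 {n p : ℕ} (D : Set (EuclideanSpace ℝ (Fin n)))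
    (hne : D.Nonempty) (hconv : Convex ℝ D)
    (ΓL ΓU : Fin p → EuclideanSpace ℝ (Fin n) → ℝ)
    (subL subU : Fin p → EuclideanSpace ℝ (Fin n) → Set (EuclideanSpace ℝ (Fin n)))
    (hint : ∀ i, ∀ x ∈ D, ΓL i x ≤ ΓU i x)
    (hlipL : ∀ i, LocallyLipschitzOnD D (ΓL i))
    (hlipU : ∀ i, LocallyLipschitzOnD D (ΓU i))
    (hcfL : ∀ i, HasBoundedConvexificatorOn D (ΓL i) (subL i))
    (hcfU : ∀ i, HasBoundedConvexificatorOn D (ΓU i) (subU i))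
    (hcvxL : ∀ i, DConvexOn D (ΓL i) (subL i))
    (hcvxU : ∀ i, DConvexOn D (ΓU i) (subU i))
    (ω : EuclideanSpace ℝ (Fin n)) (hω : ω ∈ D)
    (hsol : IsWeakLUEfficient D ΓL ΓU ω)
    : SolvesIWSVVLIP D subL subU ω := by
  rintro ⟨v, hv, ξL, ξU, hξL, hξU, hneg⟩
  refine hsol ⟨v, hv, fun i => ?_⟩
  have hL := (hcvxL i).lt_of_inner_neg hω hv (hξL i) (hneg i).1
  have hU := (hcvxU i).lt_of_inner_neg hω hv (hξU i) (hneg i).2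
  exact ⟨⟨hL.le, hU.le⟩, Or.inl hL.ne⟩
end

section
/- Let D ⊆ ℝⁿ be a nonempty convex set and Γ = (Γ₁, …, Γ_p) an interval-valued vector function on D such that each Γ_i^L and Γ_i^U is locally Lipschitz on D and admits a bounded convexificator at every point of D, and suppose Γ is ∂-LU-convex on D. If ω ∈ D solves the weak Minty-type inequality (IWMVVLIP), then ω solves the weak Stampacchia-type inequality (IWSVVLIP). -/
open RealInnerProductSpace

theorem diniLower_zero {n : ℕ} (f : EuclideanSpace ℝ (Fin n) → ℝ)
    (x : EuclideanSpace ℝ (Fin n)) : diniLower f x 0 = 0 := by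
  simp [diniLower]

/-- If some `ξ ∈ sub v` is negative along `v - ω`, then so is every `ζ ∈ sub ω`: the map `sub` of
a `∂`-convex function is monotone. -/
theorem DConvexOn.inner_neg {n : ℕ} {D : Set (EuclideanSpace ℝ (Fin n))}
    {f : EuclideanSpace ℝ (Fin n) → ℝ}
    {sub : EuclideanSpace ℝ (Fin n) → Set (EuclideanSpace ℝ (Fin n))}
    (h : DConvexOn D f sub) {ω v ζ ξ : EuclideanSpace ℝ (Fin n)} (hω : ω ∈ D) (hv : v ∈ D)
    (hζ : ζ ∈ sub ω) (hξ : ξ ∈ sub v) (hneg : ⟪ξ, v - ω⟫ < 0) : ⟪ζ, v - ω⟫ < 0 := by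
  have h₁ := h ω hω v hv ζ hζ
  have h₂ := h v hv ω hω ξ hξ
  rw [← neg_sub v ω, inner_neg_right] at h₂
  linarith

theorem stmt_5 {n p : ℕ} (D : Set (EuclideanSpace ℝ (Fin n)))
    (hne : D.Nonempty) (hconv : Convex ℝ D)
    (ΓL ΓU : Fin p → EuclideanSpace ℝ (Fin n) → ℝ)
    (subL subU : Fin p → EuclideanSpace ℝ (Fin n) → Set (EuclideanSpace ℝ (Fin n)))
    (hint : ∀ i, ∀ x ∈ D, ΓL i x ≤ ΓU i x)
    (hlipL : ∀ i, LocallyLipschitzOnD D (ΓL i))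
    (hlipU : ∀ i, LocallyLipschitzOnD D (ΓU i))
    (hcfL : ∀ i, HasBoundedConvexificatorOn D (ΓL i) (subL i))
    (hcfU : ∀ i, HasBoundedConvexificatorOn D (ΓU i) (subU i))
    (hcvxL : ∀ i, DConvexOn D (ΓL i) (subL i))
    (hcvxU : ∀ i, DConvexOn D (ΓU i) (subU i))
    (ω : EuclideanSpace ℝ (Fin n)) (hω : ω ∈ D)
    (hsol : SolvesIWMVVLIP D subL subU ω)
    : SolvesIWSVVLIP D subL subU ω := by
  rintro ⟨v, hv, ξL, ξU, hξL, hξU, hneg⟩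
  choose ζL hζL using fun i => (hcfL i ω hω).1.nonempty
  choose ζU hζU using fun i => (hcfU i ω hω).1.nonempty
  exact hsol ⟨v, hv, ζL, ζU, hζL, hζU, fun i =>
    ⟨(hcvxL i).inner_neg hω hv (hζL i) (hξL i) (hneg i).1,
      (hcvxU i).inner_neg hω hv (hζU i) (hξU i) (hneg i).2⟩⟩
end

section
/- Mean value theorem for convexificators: Let a, b ∈ ℝⁿ with a ≠ b, and let Γ : ℝⁿ → ℝ be finite and continuous on the closed segment [a, b] and admit a bounded convexificator ∂Γ(w) at every point w of the segment [a, b]. Then there exist c in the open segment (a, b) and ζ in the convex hull of ∂Γ(c) such that Γ(b) − Γ(a) = ⟨ζ, b − a⟩. -/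
open RealInnerProductSpace

open Filter Topology in
lemma diniUpperD_le_of_eventually {n : ℕ} {f : EuclideanSpace ℝ (Fin n) → ℝ}
    {x w : EuclideanSpace ℝ (Fin n)} {K : ℝ}
    (h : ∀ᶠ t : ℝ in 𝓝[>] 0, f (x + t • w) - f x ≤ K * t) : diniUpperD f x w ≤ K := by
  refine limsup_le_of_le (by isBoundedDefault) ?_
  filter_upwards [h, self_mem_nhdsWithin] with t ht ht0
  exact EReal.coe_le_coe_iff.2 ((div_le_iff₀ ht0).2 ht)

open Filter Topology in
lemma le_diniLower_of_eventually {n : ℕ} {f : EuclideanSpace ℝ (Fin n) → ℝ}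
    {x w : EuclideanSpace ℝ (Fin n)} {K : ℝ}
    (h : ∀ᶠ t : ℝ in 𝓝[>] 0, K * t ≤ f (x + t • w) - f x) : K ≤ diniLower f x w := by
  refine le_liminf_of_le (by isBoundedDefault) ?_
  filter_upwards [h, self_mem_nhdsWithin] with t ht ht0
  exact EReal.coe_le_coe_iff.2 ((le_div_iff₀ ht0).2 ht)

/-- A finite upper bound on the infimum of a linear functional over a compact set is attained. -/
lemma IsCompact.exists_inner_le_of_iInf_le {E : Type*} [NormedAddCommGroup E]
    [InnerProductSpace ℝ E] {S : Set E} (hS : IsCompact S) {w : E} {K : ℝ}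
    (h : (⨅ ζ ∈ S, ((⟪ζ, w⟫ : ℝ) : EReal)) ≤ K) : ∃ ζ ∈ S, ⟪ζ, w⟫ ≤ K := by
  rcases S.eq_empty_or_nonempty with rfl | hne
  · simp at h
  obtain ⟨ζ, hζ, hmin⟩ := hS.exists_isMinOn hne
    (f := fun ζ => (⟪ζ, w⟫ : ℝ)) (by fun_prop)
  refine ⟨ζ, hζ, EReal.coe_le_coe_iff.1 (le_trans (le_iInf₂ fun ξ hξ => ?_) h)⟩
  exact EReal.coe_le_coe_iff.2 (hmin hξ)

/-- A finite lower bound on the supremum of a linear functional over a compact set is attained. -/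
lemma IsCompact.exists_le_inner_of_le_iSup {E : Type*} [NormedAddCommGroup E]
    [InnerProductSpace ℝ E] {S : Set E} (hS : IsCompact S) {w : E} {K : ℝ}
    (h : (K : EReal) ≤ ⨆ ζ ∈ S, ((⟪ζ, w⟫ : ℝ) : EReal)) : ∃ ζ ∈ S, K ≤ ⟪ζ, w⟫ := by
  rcases S.eq_empty_or_nonempty with rfl | hne
  · simp at h
  obtain ⟨ζ, hζ, hmax⟩ := hS.exists_isMaxOn hne
    (f := fun ζ => (⟪ζ, w⟫ : ℝ)) (by fun_prop)
  refine ⟨ζ, hζ, EReal.coe_le_coe_iff.1 (h.trans (iSup₂_le fun ξ hξ => ?_))⟩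
  exact EReal.coe_le_coe_iff.2 (hmax hξ)

lemma exists_mem_convexHull_inner_eq {E : Type*} [NormedAddCommGroup E]
    [InnerProductSpace ℝ E] {S : Set E} {w ζ₁ ζ₂ : E} {K : ℝ} (h₁ : ζ₁ ∈ S) (h₂ : ζ₂ ∈ S)
    (hK₁ : ⟪ζ₁, w⟫ ≤ K) (hK₂ : K ≤ ⟪ζ₂, w⟫) : ∃ ζ ∈ convexHull ℝ S, K = ⟪ζ, w⟫ := by
  obtain ⟨ζ, hζ, h⟩ := (convex_convexHull ℝ S).isPreconnected.intermediate_value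
    (subset_convexHull ℝ S h₁) (subset_convexHull ℝ S h₂)
    (f := fun ζ => (⟪ζ, w⟫ : ℝ)) (by fun_prop) ⟨hK₁, hK₂⟩
  exact ⟨ζ, hζ, h.symm⟩

theorem stmt_8 {n : ℕ} (a b : EuclideanSpace ℝ (Fin n)) (hab : a ≠ b)
    (Γ : EuclideanSpace ℝ (Fin n) → ℝ)
    (sub : EuclideanSpace ℝ (Fin n) → Set (EuclideanSpace ℝ (Fin n)))
    (hcont : ContinuousOn Γ (segment ℝ a b))
    (hcf : ∀ w ∈ segment ℝ a b, IsConvexificatorAt Γ w (sub w) ∧ Bornology.IsBounded (sub w)) :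
    ∃ c ∈ openSegment ℝ a b, ∃ ζ ∈ convexHull ℝ (sub c), Γ b - Γ a = ⟪ζ, b - a⟫ := by
  set K := Γ b - Γ a with hK
  let γ : ℝ → EuclideanSpace ℝ (Fin n) := fun t => a + t • (b - a)
  let h : ℝ → ℝ := fun t => Γ (γ t) - t * K
  have hmem : ∀ t ∈ Set.Icc (0 : ℝ) 1, γ t ∈ segment ℝ a b := fun t ht => by
    rw [segment_eq_image']
    exact ⟨t, ht, rfl⟩
  have hh : ContinuousOn h (Set.Icc 0 1) :=
    (hcont.comp (by fun_prop) hmem).sub (by fun_prop)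
  have h01 : h 0 = h 1 := by simp [h, γ, hK]
  obtain ⟨s, hs, hext⟩ := exists_isLocalExtr_Ioo one_pos hh h01
  have hsc : γ s ∈ openSegment ℝ a b := by
    rw [openSegment_eq_image']
    exact ⟨s, hs, rfl⟩
  obtain ⟨⟨hclosed, hlow, hup⟩, hbdd⟩ := hcf (γ s) (hmem s (Set.Ioo_subset_Icc_self hs))
  have hcomp := Metric.isCompact_of_isClosed_isBounded hclosed hbdd
  have hplus : Filter.Tendsto (fun t : ℝ => s + t) (nhdsWithin 0 (Set.Ioi 0)) (nhds s) :=
    tendsto_nhdsWithin_of_tendsto_nhds (Continuous.tendsto' (by fun_prop) _ _ (by simp))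
  have hminus : Filter.Tendsto (fun t : ℝ => s - t) (nhdsWithin 0 (Set.Ioi 0)) (nhds s) :=
    tendsto_nhdsWithin_of_tendsto_nhds (Continuous.tendsto' (by fun_prop) _ _ (by simp))
  have eplus : ∀ t : ℝ, γ (s + t) = γ s + t • (b - a) := fun t => by
    simp only [γ]; module
  have eminus : ∀ t : ℝ, γ (s - t) = γ s + t • (-(b - a)) := fun t => by
    simp only [γ]; module
  refine ⟨γ s, hsc, ?_⟩
  rcases hext with hmin | hmax
  · obtain ⟨ζ₂, hζ₂, h₂⟩ := hcomp.exists_le_inner_of_le_iSup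
      (w := b - a) (K := K) ((le_diniLower_of_eventually (by
        filter_upwards [hplus.eventually hmin] with t ht
        simp only [h, eplus] at ht
        linarith)).trans (hlow _))
    obtain ⟨ζ₁, hζ₁, h₁⟩ := hcomp.exists_le_inner_of_le_iSup
      (w := -(b - a)) (K := -K) ((le_diniLower_of_eventually (by
        filter_upwards [hminus.eventually hmin] with t ht
        simp only [h, eminus] at ht
        linarith)).trans (hlow _))
    rw [inner_neg_right, neg_le_neg_iff] at h₁
    exact exists_mem_convexHull_inner_eq hζ₁ hζ₂ h₁ h₂
  · obtain ⟨ζ₁, hζ₁, h₁⟩ := hcomp.exists_inner_le_of_iInf_le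
      (w := b - a) (K := K) ((hup _).trans (diniUpperD_le_of_eventually (by
        filter_upwards [hplus.eventually hmax] with t ht
        simp only [h, eplus] at ht
        linarith)))
    obtain ⟨ζ₂, hζ₂, h₂⟩ := hcomp.exists_inner_le_of_iInf_le
      (w := -(b - a)) (K := -K) ((hup _).trans (diniUpperD_le_of_eventually (by
        filter_upwards [hminus.eventually hmax] with t ht
        simp only [h, eminus] at ht
        linarith)))
    rw [inner_neg_right, neg_le_neg_iff] at h₂
    exact exists_mem_convexHull_inner_eq hζ₁ hζ₂ h₁ h₂
end

section
/- Let D ⊆ ℝⁿ be a nonempty convex set and Γ = (Γ₁, …, Γ_p) : D → ℝᵖ a vector-valued function such that each component Γ_k is locally Lipschitz on D and admits a bounded convexificator ∂Γ_k(x) at every x ∈ D. Then Γ is ∂-convex on D (i.e., each Γ_k is ∂-convex on D) if and only if the convexificator map is monotone on D, i.e., for all x, y ∈ D, every k, and all ζ ∈ ∂Γ_k(x), ξ ∈ ∂Γ_k(y), one has ⟨ζ − ξ, x − y⟩ ≥ 0. -/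
open RealInnerProductSpace

open Set Filter Topology in
/-- A continuous function on `[0, 1]` whose upper right Dini derivative is at least `c` on `(0, 1)`
grows by at least `c`. -/
lemma le_sub_of_frequently_lt_slope {φ : ℝ → ℝ} {c : ℝ} (hφ : ContinuousOn φ (Icc 0 1))
    (h : ∀ t ∈ Ioo (0 : ℝ) 1, ∀ r < c, ∃ᶠ s in 𝓝[>] (0 : ℝ), r < (φ (t + s) - φ t) / s) :
    c ≤ φ 1 - φ 0 := by
  have key : ∀ ε ∈ Ioo (0 : ℝ) 1, c * (1 - ε) ≤ φ 1 - φ ε := by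
    intro ε hε
    have hle := image_le_of_liminf_slope_right_le_deriv_boundary
      (f := fun t => -φ t) (a := ε) (b := 1) (B := fun t => -φ ε - c * (t - ε))
      (B' := fun _ => -c) (hφ.mono (Icc_subset_Icc_left hε.1.le)).neg (by simp)
      (by fun_prop)
      (fun x _ => by
        have := (((hasDerivAt_id x).sub_const ε).const_mul c).const_sub (-φ ε)
        simpa using this.hasDerivWithinAt)
      (fun x hx r hr => by
        have hmap : Tendsto (fun s => x + s) (𝓝[>] (0 : ℝ)) (𝓝[>] x) := by
          refine tendsto_nhdsWithin_iff.2 ⟨?_, ?_⟩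
          · have : Tendsto (fun s : ℝ => x + s) (𝓝 0) (𝓝 (x + 0)) :=
              (continuous_const.add continuous_id).tendsto 0
            rw [add_zero] at this
            exact this.mono_left nhdsWithin_le_nhds
          · filter_upwards [self_mem_nhdsWithin] with s hs
            simpa using hs
        refine hmap.frequently ((h x ⟨hε.1.trans_le hx.1, hx.2⟩ (-r) (by linarith)).mono ?_)
        intro s hs
        have hslope : slope (fun t => -φ t) x (x + s) = -((φ (x + s) - φ x) / s) := by
          rw [slope_def_field]
          ring
        rw [hslope]
        linarith)
      (right_mem_Icc.2 hε.2.le)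
    linarith
  have hcont : Tendsto φ (𝓝[>] 0) (𝓝 (φ 0)) := by
    rw [← nhdsWithin_Ioo_eq_nhdsGT (zero_lt_one' ℝ)]
    exact (hφ 0 (by simp)).mono Ioo_subset_Icc_self
  have hlin : Tendsto (fun ε : ℝ => c * (1 - ε)) (𝓝[>] 0) (𝓝 (c * (1 - 0))) :=
    ((by fun_prop : Continuous fun ε : ℝ => c * (1 - ε)).tendsto 0).mono_left nhdsWithin_le_nhds
  rw [sub_zero, mul_one] at hlin
  exact le_of_tendsto_of_tendsto hlin (hcont.const_sub (φ 1))
    (eventually_of_mem (Ioo_mem_nhdsGT zero_lt_one) key)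

lemma LocallyLipschitzOnD.continuousOn {n : ℕ} {D : Set (EuclideanSpace ℝ (Fin n))}
    {f : EuclideanSpace ℝ (Fin n) → ℝ} (hf : LocallyLipschitzOnD D f) : ContinuousOn f D := by
  intro x hx
  obtain ⟨M, hM, δ, hδ, h⟩ := hf x hx
  refine Metric.continuousWithinAt_iff.2 fun ε hε =>
    ⟨min δ (ε / M), lt_min hδ (div_pos hε hM), fun y hy hyx => ?_⟩
  rw [dist_eq_norm] at hyx
  rw [Real.dist_eq]
  refine (h y hy x hx (hyx.trans_le (min_le_left _ _)) (by simpa using hδ)).trans_lt ?_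
  rw [mul_comm, ← lt_div_iff₀ hM]
  exact hyx.trans_le (min_le_right _ _)

open Set Filter Topology in
lemma dConvexOn_of_monotone {n : ℕ} {D : Set (EuclideanSpace ℝ (Fin n))} (hconv : Convex ℝ D)
    {f : EuclideanSpace ℝ (Fin n) → ℝ}
    {sub : EuclideanSpace ℝ (Fin n) → Set (EuclideanSpace ℝ (Fin n))}
    (hf : ContinuousOn f D) (hcf : ∀ x ∈ D, IsConvexificatorAt f x (sub x))
    (hmono : ∀ x ∈ D, ∀ y ∈ D, ∀ ζ ∈ sub x, ∀ ξ ∈ sub y, 0 ≤ ⟪ζ - ξ, x - y⟫) :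
    DConvexOn D f sub := by
  intro ω hω v hv ζ hζ
  have hmem : ∀ t ∈ Icc (0 : ℝ) 1, ω + t • (v - ω) ∈ D := fun t ht =>
    hconv.add_smul_sub_mem hω hv ht
  have hφ : ContinuousOn (fun t : ℝ => f (ω + t • (v - ω))) (Icc 0 1) :=
    hf.comp (by fun_prop) hmem
  have := le_sub_of_frequently_lt_slope (c := ⟪ζ, v - ω⟫) hφ ?_
  · simpa using this
  intro t ht r hr
  have htD := hmem t (Ioo_subset_Icc_self ht)
  have hinf : ((⟪ζ, v - ω⟫ : ℝ) : EReal) ≤ diniUpperD f (ω + t • (v - ω)) (v - ω) := by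
    refine le_trans (le_iInf₂ fun ξ hξ => ?_) ((hcf _ htD).2.2 (v - ω))
    have hm := hmono _ htD ω hω ξ hξ ζ hζ
    rw [add_sub_cancel_left, real_inner_smul_right] at hm
    have hm' := nonneg_of_mul_nonneg_right hm ht.1
    rw [inner_sub_left] at hm'
    exact EReal.coe_le_coe_iff.2 (by linarith)
  have hfreq := frequently_lt_of_lt_limsup (by isBoundedDefault)
    ((EReal.coe_lt_coe_iff.2 hr).trans_le hinf)
  refine hfreq.mono fun s hs => ?_
  rw [add_smul, ← add_assoc]
  exact EReal.coe_lt_coe_iff.1 hs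

theorem stmt_9 {n p : ℕ} (D : Set (EuclideanSpace ℝ (Fin n)))
    (hne : D.Nonempty) (hconv : Convex ℝ D)
    (Γ : Fin p → EuclideanSpace ℝ (Fin n) → ℝ)
    (sub : Fin p → EuclideanSpace ℝ (Fin n) → Set (EuclideanSpace ℝ (Fin n)))
    (hlip : ∀ k, LocallyLipschitzOnD D (Γ k))
    (hcf : ∀ k, HasBoundedConvexificatorOn D (Γ k) (sub k)) :
    (∀ k, DConvexOn D (Γ k) (sub k)) ↔
      (∀ x ∈ D, ∀ y ∈ D, ∀ k, ∀ ζ ∈ sub k x, ∀ ξ ∈ sub k y, 0 ≤ ⟪ζ - ξ, x - y⟫) := by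
  constructor
  · intro h x hx y hy k ζ hζ ξ hξ
    have h₁ := h k x hx y hy ζ hζ
    have h₂ := h k y hy x hx ξ hξ
    rw [← neg_sub x y, inner_neg_right] at h₁
    rw [inner_sub_left]
    linarith
  · intro h k
    exact dConvexOn_of_monotone hconv (hlip k).continuousOn (fun x hx => (hcf k x hx).1)
      fun x hx y hy => h x hx y hy k
end

section
/- Let D ⊆ ℝⁿ be a nonempty convex set and f : D → ℝ a locally Lipschitz function admitting a bounded convexificator ∂f(x) at every x ∈ D. If f is ∂-convex on D, then f is convex along segments in D: for all ω, v ∈ D and all t ∈ [0, 1], f(ω + t(v − ω)) − f(ω) ≤ t (f(v) − f(ω)). -/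
open RealInnerProductSpace

theorem stmt_12 {n : ℕ} (D : Set (EuclideanSpace ℝ (Fin n)))
    (hne : D.Nonempty) (hconv : Convex ℝ D)
    (f : EuclideanSpace ℝ (Fin n) → ℝ)
    (sub : EuclideanSpace ℝ (Fin n) → Set (EuclideanSpace ℝ (Fin n)))
    (hlip : LocallyLipschitzOnD D f)
    (hcf : HasBoundedConvexificatorOn D f sub)
    (hcvx : DConvexOn D f sub) :
    ∀ ω ∈ D, ∀ v ∈ D, ∀ t ∈ Set.Icc (0 : ℝ) 1,
      f (ω + t • (v - ω)) - f ω ≤ t * (f v - f ω) := by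
  intro ω hω v hv t ht
  have hx : ω + t • (v - ω) ∈ D := hconv.add_smul_sub_mem hω hv ht
  obtain ⟨ζ, hζ⟩ := (hcf _ hx).1.nonempty
  have hv' := hcvx _ hx v hv ζ hζ
  have hω' := hcvx _ hx ω hω ζ hζ
  rw [show v - (ω + t • (v - ω)) = (1 - t) • (v - ω) by module, real_inner_smul_right] at hv'
  rw [show ω - (ω + t • (v - ω)) = (-t) • (v - ω) by module, real_inner_smul_right] at hω'
  linarith [mul_le_mul_of_nonneg_left hv' ht.1,
    mul_le_mul_of_nonneg_left hω' (sub_nonneg.2 ht.2)]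
end
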